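/- Let d ≥ 1, let ψ be a cut-off function, let α > 0 and h > 0, and let b : ℝ^d → ℝ^d satisfy the following dissipativity condition: there exist R > 0, μ > 0 and b₀ > 0 such that for every x with ‖x‖ > R one has x · b(x) ≤ −μ ‖x‖ ‖b(x)‖ and ‖b(x)‖ ≥ b₀. Define b^h(x) := b(x)/(1 + ψ(h^α ‖b(x)‖)). Then for every x with ‖x‖ > R one has x · b^h(x) ≤ −μ ‖x‖ · b₀/(1 + h^α b₀) ≤ −(μ/2) ‖x‖ · min(b₀, h^{-α}). -/

import Mathlib

open scoped RealInnerProductSpace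

/-- A cut-off function: smooth, nondecreasing, vanishing on `(-∞, 1]`, equal to the
identity on `[2, ∞)`, and satisfying `0 ≤ ψ r ≤ r` for `r ≥ 0`. -/
def IsCutoff (ψ : ℝ → ℝ) : Prop :=
  ContDiff ℝ (⊤ : ℕ∞) ψ ∧ Monotone ψ ∧ (∀ r : ℝ, r ≤ 1 → ψ r = 0) ∧
    (∀ r : ℝ, 2 ≤ r → ψ r = r) ∧ ∀ r : ℝ, 0 ≤ r → 0 ≤ ψ r ∧ ψ r ≤ r

/-- The map `t ↦ t / (1 + c t)` is nondecreasing on the positive reals. -/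
lemma div_one_add_mul_le_div_one_add_mul {c s t : ℝ} (hc : 0 < c) (hs : 0 < s) (hst : s ≤ t) :
    s / (1 + c * s) ≤ t / (1 + c * t) := by
  have ht : 0 < t := hs.trans_le hst
  rw [div_le_div_iff₀ (by positivity) (by positivity)]
  linarith

lemma half_min_inv_le_div_one_add_mul {c s : ℝ} (hc : 0 < c) (hs : 0 < s) :
    min s c⁻¹ / 2 ≤ s / (1 + c * s) := by
  rw [div_le_div_iff₀ two_pos (by positivity)]
  have hmul : c * min s c⁻¹ ≤ 1 := by
    calc c * min s c⁻¹ ≤ c * c⁻¹ := by gcongr; exact min_le_right _ _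
      _ = 1 := mul_inv_cancel₀ hc.ne'
  linarith [min_le_left s c⁻¹, mul_le_mul_of_nonneg_right hmul hs.le]

/-- The modified tamed map inherits dissipativity: if `x ⬝ b x ≤ -μ ‖x‖ ‖b x‖` and
`‖b x‖ ≥ b₀` for `‖x‖ > R`, then for such `x`,
`x ⬝ b^h x ≤ -μ ‖x‖ b₀ / (1 + h^α b₀) ≤ -(μ/2) ‖x‖ min(b₀, h^{-α})`. -/
theorem modified_tamed_dissipativity
    (d : ℕ) (hd : 1 ≤ d)
    (ψ : ℝ → ℝ) (hψ : IsCutoff ψ)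
    (α h : ℝ) (hα : 0 < α) (hh : 0 < h)
    (b : EuclideanSpace ℝ (Fin d) → EuclideanSpace ℝ (Fin d))
    (R μ b₀ : ℝ) (hR : 0 < R) (hμ : 0 < μ) (hb₀ : 0 < b₀)
    (hdiss : ∀ x : EuclideanSpace ℝ (Fin d), R < ‖x‖ →
      ⟪x, b x⟫ ≤ -μ * ‖x‖ * ‖b x‖ ∧ b₀ ≤ ‖b x‖) :
    ∀ x : EuclideanSpace ℝ (Fin d), R < ‖x‖ →
      ⟪x, (1 + ψ (h ^ α * ‖b x‖))⁻¹ • b x⟫ ≤ -μ * ‖x‖ * (b₀ / (1 + h ^ α * b₀)) ∧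
      -μ * ‖x‖ * (b₀ / (1 + h ^ α * b₀)) ≤ -(μ / 2) * ‖x‖ * min b₀ (h ^ (-α)) := by
  intro x hx
  obtain ⟨hinner, hnorm⟩ := hdiss x hx
  have hc : 0 < h ^ α := Real.rpow_pos_of_pos hh α
  have hbx : 0 < ‖b x‖ := hb₀.trans_le hnorm
  have hμx : 0 ≤ μ * ‖x‖ := by positivity
  obtain ⟨hψ_nonneg, hψ_le⟩ := hψ.2.2.2.2 (h ^ α * ‖b x‖) (by positivity)
  constructor
  · have hquot : b₀ / (1 + h ^ α * b₀) ≤ (1 + ψ (h ^ α * ‖b x‖))⁻¹ * ‖b x‖ := by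
      refine (div_one_add_mul_le_div_one_add_mul hc hb₀ hnorm).trans ?_
      rw [inv_mul_eq_div]
      gcongr
    rw [real_inner_smul_right]
    have hinv : 0 ≤ (1 + ψ (h ^ α * ‖b x‖))⁻¹ := by positivity
    linarith [mul_le_mul_of_nonneg_left hinner hinv, mul_le_mul_of_nonneg_left hquot hμx]
  · rw [Real.rpow_neg hh.le]
    linarith [mul_le_mul_of_nonneg_left (half_min_inv_le_div_one_add_mul hc hb₀) hμx]
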